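/- Given any graph G on the countably infinite vertex set ℕ and any closed, infinite set Λ of real numbers, there exists a self-adjoint unbounded operator T on ℓ² such that: (i) the spectrum of T equals Λ, and (ii) every standard basis vector e_i belongs to Dom(T), and for all i ≠ j in ℕ, the matrix entry ⟨T e_j, e_i⟩ is nonzero precisely when the vertices i and j are adjacent in G (i.e., the standard matrix of T is a real symmetric matrix whose graph is G). -/

import Mathlib

/-- A real number `l` belongs to the resolvent set of an unbounded operator `T` on a real
Hilbert space `H` if there is a bounded operator `S` on `H` such that `S v ∈ Dom T` and
`(T - l•I)(S v) = v` for all `v ∈ H`, and `S ((T - l•I) w) = w` for all `w ∈ Dom T`. -/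
def unbResolventSet {H : Type*} [NormedAddCommGroup H] [InnerProductSpace ℝ H]
    (T : H →ₗ.[ℝ] H) : Set ℝ :=
  {l | ∃ S : H →L[ℝ] H,
    (∀ v : H, ∃ h : S v ∈ T.domain, T ⟨S v, h⟩ - l • S v = v) ∧
    (∀ w : T.domain, S (T w - l • (w : H)) = w)}

/-- The spectrum of an unbounded operator is the complement (in `ℝ`) of its resolvent set. -/
def unbSpectrum {H : Type*} [NormedAddCommGroup H] [InnerProductSpace ℝ H]
    (T : H →ₗ.[ℝ] H) : Set ℝ :=
  (unbResolventSet T)ᶜ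

abbrev HH : Type := lp (fun _ : ℕ => ℝ) 2

noncomputable abbrev bv (i : ℕ) : HH := lp.single 2 i (1 : ℝ)

theorem inner_bv_left (i : ℕ) (x : HH) : inner ℝ (bv i) x = x i := by
  simp [bv, lp.inner_single_left]

theorem inner_bv_right (i : ℕ) (x : HH) : inner ℝ x (bv i) = x i := by
  simp [bv, lp.inner_single_right]

theorem bv_apply (i j : ℕ) : (bv i : ℕ → ℝ) j = if i = j then 1 else 0 := by
  simp only [bv, lp.coeFn_single, Pi.single_apply]
  simp [eq_comm]

def diagDom (a : ℕ → ℝ) : Submodule ℝ HH where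
  carrier := {x | Memℓp (fun i => a i * x i) 2}
  zero_mem' := by
    have : (fun i => a i * (0 : HH) i) = (0 : ℕ → ℝ) := by ext i; simp
    show Memℓp (fun i => a i * (0 : HH) i) 2
    rw [this]; exact zero_memℓp
  add_mem' := by
    intro x y hx hy
    have := Memℓp.add hx hy
    show Memℓp (fun i => a i * (x + y) i) 2
    convert this using 1
    ext i; simp [mul_add]
  smul_mem' := by
    intro c x hx
    have := Memℓp.const_smul (𝕜 := ℝ) hx c
    show Memℓp (fun i => a i * (c • x) i) 2
    convert this using 1
    ext i; simp; ring

theorem mem_diagDom {a : ℕ → ℝ} {x : HH} : x ∈ diagDom a ↔ Memℓp (fun i => a i * x i) 2 := Iff.rfl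

noncomputable def opT (a : ℕ → ℝ) (Q : HH →L[ℝ] HH) : HH →ₗ.[ℝ] HH where
  domain := diagDom a
  toFun :=
    { toFun := fun x => (⟨fun i => a i * (x : HH) i, x.2⟩ : HH) + Q x
      map_add' := by
        intro x y
        apply lp.ext; ext i
        show a i * ((x : HH) i + (y : HH) i) + (Q ((x : HH) + y)) i =
          (a i * (x : HH) i + (Q x) i) + (a i * (y : HH) i + (Q y) i)
        rw [map_add, lp.coeFn_add, Pi.add_apply]; ring
      map_smul' := by
        intro c x
        apply lp.ext; ext i
        show a i * (c * (x : HH) i) + (Q (c • (x : HH))) i = c * (a i * (x : HH) i + (Q x) i)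
        rw [map_smul, lp.coeFn_smul, Pi.smul_apply, smul_eq_mul]; ring }

theorem opT_apply (a : ℕ → ℝ) (Q : HH →L[ℝ] HH) (x : (opT a Q).domain) (i : ℕ) :
    (opT a Q x) i = a i * (x : HH) i + (Q x) i := rfl

theorem opT_sub (a : ℕ → ℝ) (Q Q' : HH →L[ℝ] HH) (x : HH) (hx : x ∈ diagDom a) :
    opT a Q ⟨x, hx⟩ = opT a Q' ⟨x, hx⟩ + (Q - Q') x := by
  apply lp.ext; ext i
  have h1 := opT_apply a Q ⟨x, hx⟩ i
  have h2 := opT_apply a Q' ⟨x, hx⟩ i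
  simp only [lp.coeFn_add, Pi.add_apply, sub_apply, lp.coeFn_sub,
    Pi.sub_apply, h1, h2]
  ring

theorem bv_mem (a : ℕ → ℝ) (i : ℕ) : bv i ∈ diagDom a := by
  rw [mem_diagDom]
  refine Memℓp.of_exponent_ge (q := 0) (memℓp_zero_iff.2 ?_) (by simp)
  refine (Set.finite_singleton i).subset ?_
  intro j hj
  by_contra h
  apply hj
  have : i ≠ j := fun h' => h (by simp [h'])
  rw [bv_apply]; simp [this]

theorem diagDom_dense (a : ℕ → ℝ) : Dense (diagDom a : Set HH) := by
  rw [Submodule.dense_iff_topologicalClosure_eq_top, Submodule.topologicalClosure_eq_top_iff,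
    Submodule.eq_bot_iff]
  intro x hx
  apply lp.ext; ext i
  rw [← inner_bv_left]
  simpa using (Submodule.mem_orthogonal _ _).1 hx _ (bv_mem a i)

def SymOp (Q : HH →L[ℝ] HH) : Prop := ∀ x y, inner ℝ (Q x) y = inner ℝ x (Q y)

theorem opT_formal (a : ℕ → ℝ) (Q : HH →L[ℝ] HH) (hQ : SymOp Q) :
    (opT a Q).IsFormalAdjoint (opT a Q) := by
  intro x y
  have h : ∀ z : (opT a Q).domain,
      opT a Q z = (⟨fun i => a i * (z : HH) i, z.2⟩ : HH) + Q z := fun _ => rfl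
  rw [h, h, inner_add_left, inner_add_right, hQ]
  congr 1
  rw [lp.inner_eq_tsum, lp.inner_eq_tsum]
  congr 1; ext i
  simp; ring

theorem opT_bv (a : ℕ → ℝ) (Q : HH →L[ℝ] HH) (i : ℕ) :
    opT a Q ⟨bv i, bv_mem a i⟩ = a i • bv i + Q (bv i) := by
  apply lp.ext; ext j
  have h1 := opT_apply a Q ⟨bv i, bv_mem a i⟩ j
  rw [h1]
  simp only [lp.coeFn_add, Pi.add_apply, lp.coeFn_smul, Pi.smul_apply, bv_apply]
  by_cases h : i = j <;> simp [h]

theorem opT_selfAdjoint (a : ℕ → ℝ) (Q : HH →L[ℝ] HH) (hQ : SymOp Q) : IsSelfAdjoint (opT a Q) := by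
  rw [LinearPMap.isSelfAdjoint_def]
  have hd : Dense ((opT a Q).domain : Set HH) := diagDom_dense a
  have hle := (opT_formal a Q hQ).le_adjoint hd
  symm
  apply LinearPMap.eq_of_le_of_domain_eq hle
  apply le_antisymm hle.1
  intro v hv
  have hf := LinearPMap.adjoint_isFormalAdjoint hd ⟨v, hv⟩
  have key : (fun i => a i * v i) = ((opT a Q).adjoint ⟨v, hv⟩ - Q v : HH) := by
    ext i
    have := hf ⟨bv i, bv_mem a i⟩
    rw [opT_bv, inner_bv_right, inner_add_right, ← hQ, inner_bv_right, inner_smul_right,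
      inner_bv_right] at this
    simp [this]
  show Memℓp (fun i => a i * v i) 2
  rw [key]
  exact lp.memℓp _

theorem resolvent_of_bound (T : HH →ₗ.[ℝ] HH) (hT : IsSelfAdjoint T) (l d : ℝ) (hd : 0 < d)
    (hb : ∀ x : T.domain, d * ‖(x : HH)‖ ≤ ‖T x - l • (x : HH)‖) : l ∈ unbResolventSet T := by
  have hcl := hT.isClosed
  have hdense := hT.dense_domain
  let g : T.graph →L[ℝ] HH :=
    ((ContinuousLinearMap.snd ℝ HH HH) - l • (ContinuousLinearMap.fst ℝ HH HH)).comp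
      T.graph.subtypeL
  have hg : ∀ p : T.graph, g p = p.1.2 - l • p.1.1 := fun p => rfl
  have hgr : ∀ p : T.graph, ∃ x : T.domain, (x : HH) = p.1.1 ∧ T x = p.1.2 := fun p =>
    (LinearPMap.mem_graph_iff T).1 p.2
  have hb1 : ∀ p : T.graph, d * ‖p.1.1‖ ≤ ‖g p‖ := by
    intro p
    obtain ⟨x, h1, h2⟩ := hgr p
    rw [hg, ← h1, ← h2]; exact hb x
  have hb1' : ∀ p : T.graph, ‖p.1.1‖ ≤ d⁻¹ * ‖g p‖ := by
    intro p
    rw [inv_mul_eq_div, le_div_iff₀ hd, mul_comm]; exact hb1 p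
  have hanti : ∀ p : T.graph, ‖p‖ ≤ (d⁻¹ + (1 + |l| * d⁻¹)) * ‖g p‖ := by
    intro p
    have h1 := hb1' p
    have h2 : ‖p.1.2‖ ≤ (1 + |l| * d⁻¹) * ‖g p‖ := by
      have : p.1.2 = g p + l • p.1.1 := by rw [hg]; abel
      calc ‖p.1.2‖ = ‖g p + l • p.1.1‖ := by rw [← this]
        _ ≤ ‖g p‖ + |l| * ‖p.1.1‖ := by
            refine (norm_add_le _ _).trans ?_
            rw [norm_smul, Real.norm_eq_abs]
        _ ≤ ‖g p‖ + |l| * (d⁻¹ * ‖g p‖) := by gcongr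
        _ = _ := by ring
    have h3 : ‖p‖ = max ‖p.1.1‖ ‖p.1.2‖ := rfl
    have h4 : 0 ≤ d⁻¹ * ‖g p‖ := by positivity
    have h5 : 0 ≤ (1 + |l| * d⁻¹) * ‖g p‖ := by positivity
    rw [h3, add_mul]
    apply max_le <;> linarith
  have hC : 0 ≤ d⁻¹ + (1 + |l| * d⁻¹) := by positivity
  have hal : AntilipschitzWith ⟨_, hC⟩ g :=
    ContinuousLinearMap.antilipschitz_of_bound g hanti
  have : CompleteSpace T.graph := hcl.completeSpace_coe
  have hrc : IsClosed (Set.range g) := hal.isClosed_range g.uniformContinuous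
  have hinj : Function.Injective g := hal.injective
  have hsurj : Function.Surjective g := by
    have : g.range = ⊤ := by
      have hc : IsClosed ((g.range : Submodule ℝ HH) : Set HH) := by
        exact hrc
      rw [← hc.submodule_topologicalClosure_eq, Submodule.topologicalClosure_eq_top_iff,
        Submodule.eq_bot_iff]
      intro v hv
      rw [Submodule.mem_orthogonal] at hv
      have hv' : ∀ x : T.domain, inner ℝ (l • v) (x : HH) = inner ℝ v (T x) := by
        intro x
        have := hv (T x - l • (x : HH)) ⟨⟨((x : HH), T x), T.mem_graph x⟩, rfl⟩
        rw [inner_sub_left, inner_smul_left, real_inner_comm, real_inner_comm v] at this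
        rw [inner_smul_left]
        simp at this ⊢
        linarith
      have hmem : v ∈ T.adjoint.domain := LinearPMap.mem_adjoint_domain_of_exists v ⟨_, hv'⟩
      have hval := LinearPMap.adjoint_apply_eq hdense ⟨v, hmem⟩ hv'
      have hle : T.adjoint ≤ T := le_of_eq hT
      have hmem' : v ∈ T.domain := hle.1 hmem
      have hTv : T ⟨v, hmem'⟩ = l • v := by
        rw [← hval]; exact (hle.2 (x := ⟨v, hmem⟩) (y := ⟨v, hmem'⟩) rfl).symm
      have := hb ⟨v, hmem'⟩
      rw [hTv] at this
      simp at this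
      have h0 : ‖v‖ ≤ 0 := by
        by_contra h; push Not at h
        nlinarith
      simpa using h0
    exact LinearMap.range_eq_top.1 this
  let e := LinearEquiv.ofBijective g.toLinearMap ⟨hinj, hsurj⟩
  have he : ∀ v, g (e.symm v) = v := fun v => e.apply_symm_apply v
  let S : HH →L[ℝ] HH := LinearMap.mkContinuous
    ((LinearMap.fst ℝ HH HH).comp (T.graph.subtype.comp e.symm.toLinearMap)) d⁻¹ (by
      intro v
      have := hb1' (e.symm v)
      rw [he] at this
      exact this)
  have hS : ∀ v, S v = (e.symm v).1.1 := fun v => rfl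
  refine ⟨S, ?_, ?_⟩
  · intro v
    obtain ⟨x, h1, h2⟩ := hgr (e.symm v)
    have h3 := he v
    rw [hg, ← h1, ← h2] at h3
    have h4 : S v = x := by rw [hS, h1]
    refine ⟨h4 ▸ x.2, ?_⟩
    have h5 : (⟨S v, h4 ▸ x.2⟩ : T.domain) = x := Subtype.ext h4
    rw [h5, h4, h3]
  · intro w
    rw [hS]
    have : e.symm (T w - l • (w : HH)) = ⟨((w : HH), T w), T.mem_graph w⟩ := by
      rw [LinearEquiv.symm_apply_eq]; rfl
    rw [this]

theorem not_resolvent (T : HH →ₗ.[ℝ] HH) (l : ℝ)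
    (h : ∀ ε > 0, ∃ x : T.domain, (x : HH) ≠ 0 ∧ ‖T x - l • (x : HH)‖ ≤ ε * ‖(x : HH)‖) :
    l ∉ unbResolventSet T := by
  rintro ⟨S, -, hS⟩
  obtain ⟨x, hx, hx'⟩ := h (1 / (2 * (‖S‖ + 1))) (by positivity)
  have h1 := S.le_opNorm (T x - l • (x : HH))
  rw [hS] at h1
  have hxp : 0 < ‖(x : HH)‖ := norm_pos_iff.2 hx
  have h2 : ‖(x : HH)‖ ≤ ‖S‖ * (1 / (2 * (‖S‖ + 1)) * ‖(x : HH)‖) :=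
    h1.trans (by gcongr)
  have h3 : ‖S‖ * (1 / (2 * (‖S‖ + 1))) ≤ 1 / 2 := by
    rw [mul_one_div, div_le_div_iff₀ (by positivity) (by norm_num)]
    nlinarith [norm_nonneg S]
  nlinarith

theorem fin_total {n : ℕ} (A : Matrix (Fin n) (Fin n) ℝ) (a : Fin n → ℝ)
    (ha : Function.Injective a) (h : ∀ k, (A - a k • (1 : Matrix (Fin n) (Fin n) ℝ)).det = 0) :
    ∃ v : Fin n → Fin n → ℝ, (∀ k, v k ≠ 0 ∧ A.mulVec (v k) = a k • v k) ∧
      ∀ x : Fin n → ℝ, (∀ k, v k ⬝ᵥ x = 0) → x = 0 := by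
  have h1 : ∀ k, ∃ v : Fin n → ℝ, v ≠ 0 ∧ A.mulVec v = a k • v := by
    intro k
    obtain ⟨v, hv, hv'⟩ := Matrix.exists_mulVec_eq_zero_iff.2 (h k)
    refine ⟨v, hv, ?_⟩
    rw [Matrix.sub_mulVec, Matrix.smul_mulVec, Matrix.one_mulVec, sub_eq_zero] at hv'
    exact hv'
  choose v hv using h1
  refine ⟨v, hv, ?_⟩
  have hli : LinearIndependent ℝ v := by
    apply Module.End.eigenvectors_linearIndependent' (Matrix.toLin' A) a ha v
    intro k
    rw [Module.End.hasEigenvector_iff, Module.End.mem_eigenspace_iff]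
    exact ⟨by rw [Matrix.toLin'_apply]; exact (hv k).2, (hv k).1⟩
  have hu : IsUnit (Matrix.of v) := by
    rw [← Matrix.linearIndependent_rows_iff_isUnit]
    exact hli
  intro x hx
  have h0 : (Matrix.of v).mulVec x = 0 := by
    ext k; exact hx k
  have hinj := Matrix.mulVec_injective_iff_isUnit.2 hu
  exact hinj (by rw [h0, Matrix.mulVec_zero])

theorem fin_det_ne {n : ℕ} (A : Matrix (Fin n) (Fin n) ℝ) (hA : A.transpose = A) (a : Fin n → ℝ)
    (ha : Function.Injective a) (h : ∀ k, (A - a k • (1 : Matrix (Fin n) (Fin n) ℝ)).det = 0)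
    (m : ℝ) (hm : ∀ k, a k ≠ m) : (A - m • (1 : Matrix (Fin n) (Fin n) ℝ)).det ≠ 0 := by
  intro h0
  obtain ⟨v, hv, hv2⟩ := fin_total A a ha h
  obtain ⟨w, hw, hw'⟩ := Matrix.exists_mulVec_eq_zero_iff.2 h0
  rw [Matrix.sub_mulVec, Matrix.smul_mulVec, Matrix.one_mulVec, sub_eq_zero] at hw'
  apply hw
  apply hv2
  intro k
  have e1 : A.mulVec (v k) ⬝ᵥ w = v k ⬝ᵥ A.mulVec w := by
    rw [Matrix.dotProduct_mulVec, ← Matrix.mulVec_transpose, hA]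
  rw [hw', (hv k).2, smul_dotProduct, dotProduct_smul, smul_eq_mul, smul_eq_mul] at e1
  have e2 : (a k - m) * (v k ⬝ᵥ w) = 0 := by linarith
  exact (mul_eq_zero.1 e2).resolve_left (sub_ne_zero.2 (hm k))

noncomputable def stMat (a : ℕ → ℝ) (n : ℕ) (Q : HH →L[ℝ] HH) : Matrix (Fin n) (Fin n) ℝ :=
  Matrix.of fun i j => (if i = j then a i else 0) + (Q (bv j)) (i : ℕ)

structure Stage (G : SimpleGraph ℕ) (a : ℕ → ℝ) (n : ℕ) (Q : HH →L[ℝ] HH) : Prop where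
  sym : SymOp Q
  zero : ∀ j, n ≤ j → Q (bv j) = 0
  adj : ∀ i j : ℕ, i < n → j < n → i ≠ j → ((Q (bv j)) i ≠ 0 ↔ G.Adj i j)
  det : ∀ k : Fin n, (stMat a n Q - a k • (1 : Matrix (Fin n) (Fin n) ℝ)).det = 0
  jac : (Matrix.of fun k i : Fin n =>
    (stMat a n Q - a k • (1 : Matrix (Fin n) (Fin n) ℝ)).adjugate i i).det ≠ 0

theorem SymOp.coord {Q : HH →L[ℝ] HH} (h : SymOp Q) (i j : ℕ) : (Q (bv j)) i = (Q (bv i)) j := by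
  rw [← inner_bv_left, ← h, inner_bv_right]

theorem stMat_transpose {a : ℕ → ℝ} {n : ℕ} {Q : HH →L[ℝ] HH} (h : SymOp Q) :
    (stMat a n Q).transpose = stMat a n Q := by
  ext i j
  simp only [stMat, Matrix.transpose_apply, Matrix.of_apply]
  rw [h.coord]
  by_cases hij : i = j
  · subst hij; rfl
  · simp [hij, Ne.symm hij]

theorem stage_basis {G : SimpleGraph ℕ} {a : ℕ → ℝ} (ha : Function.Injective a) {n : ℕ}
    {Q : HH →L[ℝ] HH} (h : Stage G a n Q) :
    ∃ b : ℕ → HH, (∀ k, b k ≠ 0) ∧ (∀ k, ∃ hb : b k ∈ (opT a Q).domain,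
      opT a Q ⟨b k, hb⟩ = a k • b k) ∧ ∀ x : HH, (∀ k, inner ℝ (b k) x = 0) → x = 0 := by
  obtain ⟨v, hv, hv2⟩ := fin_total (stMat a n Q) (fun k => a k)
    (fun i j hij => Fin.ext (ha hij)) h.det
  let b : ℕ → HH := fun k => if hk : k < n then ∑ i : Fin n, v ⟨k, hk⟩ i • bv i else bv k
  have hb1 : ∀ k : Fin n, b k = ∑ i : Fin n, v k i • bv i := by
    intro k; simp [b]
  have hb2 : ∀ k, ¬ k < n → b k = bv k := by
    intro k hk; simp [b, hk]
  have hinner : ∀ (k : Fin n) (x : HH), inner ℝ (b k) x = v k ⬝ᵥ (fun i : Fin n => x i) := by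
    intro k x
    rw [hb1, sum_inner]
    simp only [dotProduct, inner_smul_left, inner_bv_left]
    simp
  have hcoord : ∀ (k : Fin n) (i : ℕ), (b k) i = if hi : i < n then v k ⟨i, hi⟩ else 0 := by
    intro k i
    rw [← inner_bv_right, hinner]
    simp only [dotProduct, bv_apply]
    split_ifs with hi
    · rw [Finset.sum_eq_single ⟨i, hi⟩]
      · simp
      · intro j _ hj
        have : i ≠ j := fun h => hj (Fin.ext h.symm)
        simp [this]
      · simp
    · apply Finset.sum_eq_zero
      intro j _
      have : i ≠ j := by have := j.2; omega
      simp [this]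
  refine ⟨b, ?_, ?_, ?_⟩
  · intro k
    by_cases hk : k < n
    · intro h0
      apply (hv ⟨k, hk⟩).1
      ext i
      have := hcoord ⟨k, hk⟩ i
      simp only [h0, i.2, dif_pos] at this
      simpa using this.symm
    · rw [hb2 k hk]
      intro h0
      have := bv_apply k k
      rw [h0] at this
      simp at this
  · intro k
    by_cases hk : k < n
    · have hmem : b k ∈ diagDom a := by
        have := hb1 ⟨k, hk⟩
        simp only at this
        rw [this]
        exact Submodule.sum_mem _ fun i _ => Submodule.smul_mem _ _ (bv_mem a i)
      refine ⟨hmem, ?_⟩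
      apply lp.ext; ext i
      rw [opT_apply]
      show a i * (b k) i + (Q (b k)) i = (a k • b k : HH) i
      have e1 : (Q (b k)) i = v ⟨k, hk⟩ ⬝ᵥ fun j : Fin n => (Q (bv j)) i := by
        have : (Q (b k)) i = inner ℝ (b k) (Q (bv i)) := by
          rw [← h.sym, inner_bv_right]
        rw [this]
        have h2 := hinner ⟨k, hk⟩ (Q (bv i))
        simp only at h2
        rw [h2]
        congr 1; ext j
        exact h.sym.coord _ _
      have e2 := hcoord ⟨k, hk⟩ i
      simp only at e2
      rw [lp.coeFn_smul, Pi.smul_apply, smul_eq_mul, e1, e2]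
      by_cases hi : i < n
      · have e3 := congrFun (hv ⟨k, hk⟩).2 ⟨i, hi⟩
        simp only [hi, dif_pos]
        rw [Pi.smul_apply, smul_eq_mul] at e3
        rw [← e3]
        simp only [Matrix.mulVec, stMat, dotProduct, Matrix.of_apply, add_mul,
          Finset.sum_add_distrib, ite_mul, zero_mul]
        simp [mul_comm]
      · simp only [hi, dif_neg, not_false_eq_true, mul_zero, zero_add]
        apply Finset.sum_eq_zero
        intro j _
        have e4 : (Q (bv j)) i = 0 := by
          rw [h.sym.coord, h.zero i (by omega)]; simp
        simp only [e4, mul_zero]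
    · have hmem : b k ∈ diagDom a := by rw [hb2 k hk]; exact bv_mem a k
      refine ⟨hmem, ?_⟩
      have : (⟨b k, hmem⟩ : (opT a Q).domain) = ⟨bv k, bv_mem a k⟩ := Subtype.ext (hb2 k hk)
      rw [this, opT_bv, h.zero k (by omega), hb2 k hk, add_zero]
  · intro x hx
    have hx1 : (fun i : Fin n => x i) = 0 := by
      apply hv2
      intro k
      rw [← hinner]; exact hx k
    apply lp.ext; ext i
    by_cases hi : i < n
    · exact congrFun hx1 ⟨i, hi⟩
    · have := hx i
      rw [hb2 i hi, inner_bv_left] at this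
      simpa using this

theorem stage_bound {G : SimpleGraph ℕ} {a : ℕ → ℝ} (ha : Function.Injective a) {n : ℕ}
    {Q : HH →L[ℝ] HH} (h : Stage G a n Q) (l d : ℝ) (hd : 0 ≤ d) (hl : ∀ k, d ≤ |a k - l|)
    (x : (opT a Q).domain) : d * ‖(x : HH)‖ ≤ ‖opT a Q x - l • (x : HH)‖ := by
  obtain ⟨b, hb0, hbe, hbt⟩ := stage_basis ha h
  have hform := opT_formal a Q h.sym
  have hkey : ∀ k (y : (opT a Q).domain), inner ℝ (b k) (opT a Q y) = a k * inner ℝ (b k) (y : HH) := by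
    intro k y
    obtain ⟨hm, he⟩ := hbe k
    have := hform ⟨b k, hm⟩ y
    rw [he, inner_smul_left] at this
    simpa using this.symm
  have horth : ∀ i j, i ≠ j → inner ℝ (b i) (b j) = 0 := by
    intro i j hij
    obtain ⟨hm, he⟩ := hbe j
    have := hkey i ⟨b j, hm⟩
    rw [he, inner_smul_right] at this
    have h2 : (a j - a i) * inner ℝ (b i) (b j) = 0 := by linarith
    exact (mul_eq_zero.1 h2).resolve_left (sub_ne_zero.2 fun h => hij (ha h).symm)
  let c : ℕ → HH := fun k => (‖b k‖⁻¹ : ℝ) • b k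
  have hc : Orthonormal ℝ c := by
    constructor
    · intro k
      simp only [c]
      rw [norm_smul, norm_inv, norm_norm, inv_mul_cancel₀ (norm_ne_zero_iff.2 (hb0 k))]
    · intro i j hij
      simp only [c]
      rw [inner_smul_left, inner_smul_right, horth i j hij]; simp
  have hci : ∀ k (x : HH), inner ℝ (c k) x = ‖b k‖⁻¹ * inner ℝ (b k) x := by
    intro k x; simp only [c]; rw [inner_smul_left]; simp
  have hspan : (Submodule.span ℝ (Set.range c))ᗮ = ⊥ := by
    rw [Submodule.eq_bot_iff]
    intro x hx
    apply hbt
    intro k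
    have := (Submodule.mem_orthogonal _ _).1 hx (c k) (Submodule.subset_span ⟨k, rfl⟩)
    rw [hci] at this
    exact (mul_eq_zero.1 this).resolve_left (inv_ne_zero (norm_ne_zero_iff.2 (hb0 k)))
  let B := HilbertBasis.mkOfOrthogonalEqBot hc hspan
  have hB : ∀ k, B k = c k := fun k => by
    simp only [B, HilbertBasis.coe_mkOfOrthogonalEqBot]
  have hsum : ∀ y : HH, HasSum (fun k => (inner ℝ (c k) y) ^ 2) (‖y‖ ^ 2) := by
    intro y
    have := B.hasSum_inner_mul_inner y y
    rw [real_inner_self_eq_norm_sq] at this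
    have hfun : (fun k => (inner ℝ (c k) y) ^ 2) =
        fun k => inner ℝ y (B k) * inner ℝ (B k) y := by
      funext k
      rw [hB, real_inner_comm y (c k), sq]
    rw [hfun]; exact this
  have hsq : d ^ 2 * ‖(x : HH)‖ ^ 2 ≤ ‖opT a Q x - l • (x : HH)‖ ^ 2 := by
    refine hasSum_le ?_ ((hsum x).mul_left (d ^ 2)) (hsum _)
    intro k
    have e : inner ℝ (c k) (opT a Q x - l • (x : HH)) = (a k - l) * inner ℝ (c k) (x : HH) := by
      rw [hci, hci, inner_sub_right, hkey, inner_smul_right]; ring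
    rw [e, mul_pow]
    apply mul_le_mul_of_nonneg_right _ (sq_nonneg _)
    rw [← sq_abs (a k - l)]
    exact pow_le_pow_left₀ hd (hl k) 2
  rw [← mul_pow] at hsq
  exact le_of_sq_le_sq hsq (norm_nonneg _)

theorem stage_zero (G : SimpleGraph ℕ) (a : ℕ → ℝ) : Stage G a 0 0 where
  sym := by intro x y; simp
  zero := by intro j _; simp
  adj := by intro i j hi; omega
  det := by intro k; exact k.elim0
  jac := by simp

noncomputable def jacM {N : ℕ} (A : Matrix (Fin N) (Fin N) ℝ) (a : Fin N → ℝ) :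
    Matrix (Fin N) (Fin N) ℝ :=
  Matrix.of fun k i : Fin N => (A - a k • (1 : Matrix (Fin N) (Fin N) ℝ)).adjugate i i

noncomputable def detCM (N : ℕ) : ContinuousMultilinearMap ℝ (fun _ : Fin N => (Fin N → ℝ)) ℝ :=
  { (Matrix.detRowAlternating (n := Fin N) (R := ℝ)).toMultilinearMap with
    cont := Continuous.matrix_det (A := fun M : Fin N → Fin N → ℝ => Matrix.of M) continuous_id }

theorem detCM_apply {N : ℕ} (M : Fin N → Fin N → ℝ) : detCM N M = (Matrix.of M).det := rfl

noncomputable def pertL {N : ℕ} (E : Matrix (Fin N) (Fin N) ℝ) :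
    (ℝ × (Fin N → ℝ)) →ₗ[ℝ] (Fin N → Fin N → ℝ) where
  toFun p := fun i j => p.1 * E i j + if i = j then p.2 i else 0
  map_add' p q := by
    ext i j; by_cases h : i = j <;> simp [h] <;> ring
  map_smul' c p := by
    ext i j; by_cases h : i = j <;> simp [h] <;> ring

theorem fin_pert {N : ℕ} (A E : Matrix (Fin N) (Fin N) ℝ) (a : Fin N → ℝ)
    (hdet : ∀ k, (A - a k • (1 : Matrix (Fin N) (Fin N) ℝ)).det = 0) (hjac : (jacM A a).det ≠ 0)
    (U : Set (ℝ × (Fin N → ℝ))) (hU : U ∈ nhds 0) :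
    ∃ p ∈ U, p.1 ≠ 0 ∧
      (∀ k, (A + p.1 • E + Matrix.diagonal p.2 - a k • (1 : Matrix (Fin N) (Fin N) ℝ)).det = 0) ∧
      (jacM (A + p.1 • E + Matrix.diagonal p.2) a).det ≠ 0 := by
  let g' : (ℝ × (Fin N → ℝ)) →L[ℝ] (Fin N → Fin N → ℝ) := LinearMap.toContinuousLinearMap (pertL E)
  have hg' : ∀ p i j, g' p i j = p.1 * E i j + if i = j then p.2 i else 0 := fun p i j => rfl
  let A0 : Fin N → (Fin N → Fin N → ℝ) := fun k i j =>
    (A - a k • (1 : Matrix (Fin N) (Fin N) ℝ)) i j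
  have hmat : ∀ k p, Matrix.of (A0 k + g' p) =
      A + p.1 • E + Matrix.diagonal p.2 - a k • (1 : Matrix (Fin N) (Fin N) ℝ) := by
    intro k p
    ext i j
    simp only [A0, Matrix.of_apply, Pi.add_apply, hg', Matrix.sub_apply, Matrix.add_apply,
      Matrix.smul_apply, Matrix.diagonal_apply, smul_eq_mul]
    ring
  let f : (ℝ × (Fin N → ℝ)) → (ℝ × (Fin N → ℝ)) := fun p => (p.1, fun k => detCM N (A0 k + g' p))
  let f' : (ℝ × (Fin N → ℝ)) →L[ℝ] (ℝ × (Fin N → ℝ)) :=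
    (ContinuousLinearMap.fst ℝ ℝ (Fin N → ℝ)).prod
      (ContinuousLinearMap.pi fun k => ((detCM N).linearDeriv (A0 k + g' 0)).comp g')
  have hf : HasStrictFDerivAt f f' 0 := by
    apply HasStrictFDerivAt.prodMk
    · exact hasStrictFDerivAt_fst
    · rw [hasStrictFDerivAt_pi]
      intro k
      have h1 : HasStrictFDerivAt (fun p => A0 k + g' p) g' 0 :=
        g'.hasStrictFDerivAt.const_add _
      exact ((detCM N).hasStrictFDerivAt (A0 k + g' 0)).comp 0 h1
  have hdiag : ∀ k (d : Fin N → ℝ), (detCM N).linearDeriv (A0 k + g' 0) (g' (0, d)) =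
      ((jacM A a).mulVec d) k := by
    intro k d
    rw [ContinuousMultilinearMap.linearDeriv_apply]
    simp only [Matrix.mulVec, dotProduct, jacM, Matrix.of_apply]
    apply Finset.sum_congr rfl
    intro i _
    have e1 : g' (0, d) i = d i • (Pi.single i 1 : Fin N → ℝ) := by
      ext j
      rw [hg']
      by_cases h : i = j
      · subst h; simp
      · simp [h, Pi.single_apply, Ne.symm h]
    rw [map_zero, add_zero, e1, ContinuousMultilinearMap.map_update_smul, Matrix.adjugate_apply,
      smul_eq_mul, mul_comm]
    rfl
  have hsurj : f'.range = ⊤ := by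
    rw [LinearMap.range_eq_top]
    rintro ⟨s, y⟩
    have hu : IsUnit (jacM A a) := (Matrix.isUnit_iff_isUnit_det _).2 (isUnit_iff_ne_zero.2 hjac)
    obtain ⟨d, hd⟩ := Matrix.mulVec_surjective_iff_isUnit.2 hu (y - (f' (s, 0)).2)
    refine ⟨(s, d), ?_⟩
    have e : ((s, d) : ℝ × (Fin N → ℝ)) = (s, 0) + (0, d) := by simp
    have e2 : f' (0, d) = (0, y - (f' (s, 0)).2) := by
      refine Prod.ext rfl ?_
      rw [← hd]
      ext k
      exact hdiag k d
    show f' (s, d) = (s, y)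
    rw [e, map_add, e2]
    refine Prod.ext ?_ ?_
    · show s + 0 = s
      simp
    · simp
  have hmap := hf.map_nhds_eq_of_surj hsurj
  have hf0 : f 0 = 0 := by
    refine Prod.ext rfl ?_
    ext k
    show detCM N (A0 k + g' 0) = 0
    rw [detCM_apply, hmat]
    simpa using hdet k
  rw [hf0] at hmap
  have hcont : Continuous fun p : ℝ × (Fin N → ℝ) =>
      (jacM (A + p.1 • E + Matrix.diagonal p.2) a).det := by
    apply Continuous.matrix_det
    apply continuous_matrix
    intro k i
    simp only [jacM, Matrix.of_apply]
    apply Continuous.matrix_elem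
    apply Continuous.matrix_adjugate
    apply Continuous.sub _ continuous_const
    apply Continuous.add
    · exact continuous_const.add (continuous_fst.smul continuous_const)
    · exact continuous_snd.matrix_diagonal
  have hV : {p : ℝ × (Fin N → ℝ) | (jacM (A + p.1 • E + Matrix.diagonal p.2) a).det ≠ 0} ∈
      nhds 0 := by
    apply (isOpen_ne_fun hcont continuous_const).mem_nhds
    simpa using hjac
  have him : f '' (U ∩ {p | (jacM (A + p.1 • E + Matrix.diagonal p.2) a).det ≠ 0}) ∈
      nhds (0 : ℝ × (Fin N → ℝ)) := by
    rw [← hmap]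
    exact Filter.image_mem_map (Filter.inter_mem hU hV)
  have hc2 : Filter.Tendsto (fun τ : ℝ => ((τ, 0) : ℝ × (Fin N → ℝ))) (nhds 0) (nhds 0) := by
    have : Continuous (fun τ : ℝ => ((τ, 0) : ℝ × (Fin N → ℝ))) := by fun_prop
    exact this.tendsto 0
  have hev := (hc2.eventually him)
  have hev2 : ∀ᶠ τ : ℝ in nhdsWithin 0 {0}ᶜ, ((τ, 0) : ℝ × (Fin N → ℝ)) ∈
      f '' (U ∩ {p | (jacM (A + p.1 • E + Matrix.diagonal p.2) a).det ≠ 0}) ∧ τ ≠ 0 :=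
    (hev.filter_mono nhdsWithin_le_nhds).and self_mem_nhdsWithin
  obtain ⟨τ, ⟨p, ⟨hpU, hpV⟩, hp⟩, hτ⟩ := hev2.exists
  have hp1 : p.1 = τ := congrArg Prod.fst hp
  refine ⟨p, hpU, by rw [hp1]; exact hτ, ?_, hpV⟩
  intro k
  have := congrFun (congrArg Prod.snd hp) k
  rw [← hmat]
  exact this

theorem blk_det {n : ℕ} (M : Matrix (Fin (n + 1)) (Fin (n + 1)) ℝ)
    (h : ∀ j : Fin n, M (Fin.last n) j.castSucc = 0) :
    M.det = M (Fin.last n) (Fin.last n) * (M.submatrix Fin.castSucc Fin.castSucc).det := by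
  rw [Matrix.det_succ_row M (Fin.last n), Fin.sum_univ_castSucc]
  rw [Finset.sum_eq_zero]
  · have : (Fin.last n).succAbove = Fin.castSucc := by
      ext i; simp
    simp [this, ← two_mul, pow_mul]
  · intro j _
    simp [h j]

theorem blk_adj {n : ℕ} (M : Matrix (Fin (n + 1)) (Fin (n + 1)) ℝ)
    (h : ∀ j : Fin n, M (Fin.last n) j.castSucc = 0) (i : Fin n) :
    M.adjugate i.castSucc i.castSucc =
      M (Fin.last n) (Fin.last n) * (M.submatrix Fin.castSucc Fin.castSucc).adjugate i i := by
  have hne : Fin.last n ≠ i.castSucc := (Fin.castSucc_lt_last i).ne'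
  rw [Matrix.adjugate_apply, Matrix.adjugate_apply, blk_det]
  · rw [Matrix.updateRow_ne hne]
    congr 2
    ext k j
    simp only [Matrix.submatrix_apply, Matrix.updateRow_apply, Pi.single_apply, Fin.castSucc_inj]
  · intro j
    rw [Matrix.updateRow_ne hne]; exact h j

theorem blk_adj_last {n : ℕ} (M : Matrix (Fin (n + 1)) (Fin (n + 1)) ℝ) :
    M.adjugate (Fin.last n) (Fin.last n) = (M.submatrix Fin.castSucc Fin.castSucc).det := by
  rw [Matrix.adjugate_apply, blk_det]
  · simp only [Matrix.updateRow_self, Pi.single_eq_same, one_mul]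
    congr 1
    ext k j
    simp only [Matrix.submatrix_apply]
    rw [Matrix.updateRow_ne (Fin.castSucc_lt_last k).ne]
  · intro j
    simp [Matrix.updateRow_self, Pi.single_apply, (Fin.castSucc_lt_last j).ne]

theorem blk_jac {n : ℕ} (C : Matrix (Fin (n + 1)) (Fin (n + 1)) ℝ) (a : ℕ → ℝ)
    (ha : Function.Injective a)
    (h : ∀ j : Fin n, C (Fin.last n) j.castSucc = 0) (hl : C (Fin.last n) (Fin.last n) = a n)
    (A : Matrix (Fin n) (Fin n) ℝ) (hA : A.transpose = A)
    (hC : C.submatrix Fin.castSucc Fin.castSucc = A)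
    (hdet : ∀ k : Fin n, (A - a k • (1 : Matrix (Fin n) (Fin n) ℝ)).det = 0)
    (hjac : (jacM A (fun k => a k)).det ≠ 0) :
    (∀ k : Fin (n + 1), (C - a k • (1 : Matrix (Fin (n + 1)) (Fin (n + 1)) ℝ)).det = 0) ∧
      (jacM C (fun k => a k)).det ≠ 0 := by
  have hr : ∀ (m : ℝ) (j : Fin n),
      (C - m • (1 : Matrix (Fin (n + 1)) (Fin (n + 1)) ℝ)) (Fin.last n) j.castSucc = 0 := by
    intro m j
    simp [h j, Matrix.one_apply, (Fin.castSucc_lt_last j).ne']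
  have hll : ∀ m : ℝ, (C - m • (1 : Matrix (Fin (n + 1)) (Fin (n + 1)) ℝ))
      (Fin.last n) (Fin.last n) = a n - m := by
    intro m; simp [hl]
  have hs : ∀ m : ℝ, (C - m • (1 : Matrix (Fin (n + 1)) (Fin (n + 1)) ℝ)).submatrix
      Fin.castSucc Fin.castSucc = A - m • (1 : Matrix (Fin n) (Fin n) ℝ) := by
    intro m
    ext i j
    simp [← hC, Matrix.one_apply]
  constructor
  · intro k
    rw [blk_det _ (hr _), hll, hs]
    induction k using Fin.lastCases with
    | last => simp
    | cast k => simp only [Fin.val_castSucc]; rw [hdet, mul_zero]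
  · intro h0
    obtain ⟨e, he, he'⟩ := Matrix.exists_mulVec_eq_zero_iff.2 h0
    apply he
    have hrow : ∀ k : Fin (n + 1),
        ∑ i : Fin n, (a n - a k) * (A - a k • (1 : Matrix (Fin n) (Fin n) ℝ)).adjugate i i
          * e i.castSucc + (A - a k • (1 : Matrix (Fin n) (Fin n) ℝ)).det * e (Fin.last n) = 0 := by
      intro k
      have := congrFun he' k
      simp only [Matrix.mulVec, dotProduct, jacM, Matrix.of_apply, Fin.sum_univ_castSucc,
        blk_adj _ (hr _), blk_adj_last, hll, hs, Pi.zero_apply] at this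
      exact this
    have h1 : (fun i : Fin n => e i.castSucc) = 0 := by
      by_contra hne
      apply hjac
      rw [← Matrix.exists_mulVec_eq_zero_iff]
      refine ⟨_, hne, ?_⟩
      ext k
      have := hrow k.castSucc
      simp only [Fin.val_castSucc, hdet, zero_mul, add_zero, mul_assoc, ← Finset.mul_sum] at this
      have hk : a n - a k ≠ 0 := sub_ne_zero.2 fun h => by
        have := ha h; have := k.2; omega
      exact (mul_eq_zero.1 this).resolve_left hk
    have h2 : e (Fin.last n) = 0 := by
      have := hrow (Fin.last n)
      simp only [Fin.val_last, sub_self, zero_mul, Finset.sum_const_zero, zero_add] at this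
      refine (mul_eq_zero.1 this).resolve_left ?_
      apply fin_det_ne A hA (fun k => a k) (fun i j hij => Fin.ext (ha hij)) hdet
      intro k hk
      have := ha hk; have := k.2; omega
    ext i
    induction i using Fin.lastCases with
    | last => simpa using h2
    | cast i => simpa using congrFun h1 i

open Classical in
noncomputable def nbr (G : SimpleGraph ℕ) (n : ℕ) : HH :=
  ∑ i ∈ Finset.range n, (if G.Adj i n then (1 : ℝ) else 0) • bv i

open Classical in
theorem nbr_apply (G : SimpleGraph ℕ) (n j : ℕ) :
    (nbr G n) j = if j < n ∧ G.Adj j n then 1 else 0 := by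
  rw [← inner_bv_right, nbr, sum_inner]
  simp only [inner_smul_left, inner_bv_right, bv_apply]
  by_cases hj : j < n
  · rw [Finset.sum_eq_single j]
    · simp [hj]
    · intro i _ hi; simp [hi]
    · intro h; simp at h; omega
  · rw [Finset.sum_eq_zero]
    · simp [hj]
    · intro i hi
      have : i ≠ j := by simp at hi; omega
      simp [this]

noncomputable def pertW (G : SimpleGraph ℕ) (n : ℕ) : HH →L[ℝ] HH :=
  InnerProductSpace.rankOne ℝ (bv n) (nbr G n) + InnerProductSpace.rankOne ℝ (nbr G n) (bv n)

theorem pertW_apply (G : SimpleGraph ℕ) (n : ℕ) (x : HH) :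
    pertW G n x = (inner ℝ (nbr G n) x : ℝ) • bv n + (inner ℝ (bv n) x : ℝ) • nbr G n := by
  simp [pertW]

theorem pertW_sym (G : SimpleGraph ℕ) (n : ℕ) : SymOp (pertW G n) := by
  intro x y
  rw [pertW_apply, pertW_apply, inner_add_left, inner_add_right]
  simp only [inner_smul_left, inner_smul_right]
  rw [real_inner_comm x (bv n), real_inner_comm x (nbr G n)]
  simp
  ring

theorem pertW_coord (G : SimpleGraph ℕ) (n i j : ℕ) : (pertW G n (bv j)) i =
    (nbr G n) j * (if n = i then 1 else 0) + (if n = j then 1 else 0) * (nbr G n) i := by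
  rw [pertW_apply, lp.coeFn_add, Pi.add_apply, lp.coeFn_smul, lp.coeFn_smul, Pi.smul_apply,
    Pi.smul_apply, inner_bv_right, inner_bv_right, bv_apply, bv_apply, smul_eq_mul, smul_eq_mul]

noncomputable def pertD (N : ℕ) (d : Fin N → ℝ) : HH →L[ℝ] HH :=
  ∑ k : Fin N, d k • InnerProductSpace.rankOne ℝ (bv k) (bv k)

theorem pertD_apply (N : ℕ) (d : Fin N → ℝ) (x : HH) :
    pertD N d x = ∑ k : Fin N, d k • (x k • bv k) := by
  simp only [pertD, sum_apply, smul_apply,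
    InnerProductSpace.rankOne_apply, inner_bv_left]

theorem pertD_sym (N : ℕ) (d : Fin N → ℝ) : SymOp (pertD N d) := by
  intro x y
  rw [pertD_apply, pertD_apply, sum_inner, inner_sum]
  apply Finset.sum_congr rfl
  intro k _
  simp only [inner_smul_left, inner_smul_right, inner_bv_left, inner_bv_right, conj_trivial]
  ring

theorem pertD_coord (N : ℕ) (d : Fin N → ℝ) (i j : ℕ) : (pertD N d (bv j)) i =
    if h : i < N then (if i = j then d ⟨i, h⟩ else 0) else 0 := by
  rw [← inner_bv_left, pertD_apply, inner_sum]
  simp only [inner_smul_right, inner_bv_left, bv_apply]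
  split_ifs with h h2
  · subst h2
    rw [Finset.sum_eq_single ⟨i, h⟩]
    · simp
    · intro k _ hk
      have : i ≠ k := fun h' => hk (Fin.ext h'.symm)
      simp [this]
    · simp
  · apply Finset.sum_eq_zero
    intro k _
    by_cases hk : j = k
    · have : (k : ℕ) ≠ i := by omega
      simp [this]
    · simp [hk]
  · apply Finset.sum_eq_zero
    intro k _
    have : (k : ℕ) ≠ i := by have := k.2; omega
    simp [this]

theorem stage_step {G : SimpleGraph ℕ} {a : ℕ → ℝ} (ha : Function.Injective a) {n : ℕ}
    {Q : HH →L[ℝ] HH} (h : Stage G a n Q) (ε : ℝ) (hε : 0 < ε) :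
    ∃ Q' : HH →L[ℝ] HH, Stage G a (n + 1) Q' ∧ ‖Q' - Q‖ < ε ∧
      ∀ i j, i < n → j < n → i ≠ j → (Q' (bv j)) i = (Q (bv j)) i := by
  have hz : ∀ i j, n ≤ i → (Q (bv j)) i = 0 := by
    intro i j hi
    rw [h.sym.coord, h.zero i hi]; simp
  have hz' : ∀ i j, n ≤ j → (Q (bv j)) i = 0 := by
    intro i j hi
    rw [h.zero j hi]; simp
  obtain ⟨hdet, hjac⟩ := blk_jac (stMat a (n + 1) Q) a ha
    (by
      intro j
      simp [stMat, (Fin.castSucc_lt_last j).ne', hz n _ le_rfl])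
    (by simp [stMat, hz n _ le_rfl])
    (stMat a n Q) (stMat_transpose h.sym)
    (by
      ext i j
      simp [stMat])
    h.det h.jac
  let E : Matrix (Fin (n + 1)) (Fin (n + 1)) ℝ := Matrix.of fun i j => (pertW G n (bv j)) (i : ℕ)
  let L : ℝ × (Fin (n + 1) → ℝ) → (HH →L[ℝ] HH) := fun p => p.1 • pertW G n + pertD (n + 1) p.2
  have hL : Continuous L := by
    simp only [L, pertD]
    fun_prop
  have hL0 : L 0 = 0 := by simp [L, pertD]
  have hU : {p | ‖L p‖ < ε} ∈ nhds 0 := by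
    apply (isOpen_lt hL.norm continuous_const).mem_nhds
    simpa [hL0] using hε
  obtain ⟨p, hp, hp1, hpd, hpj⟩ := fin_pert (stMat a (n + 1) Q) E (fun k => a k) hdet hjac _ hU
  have hco : ∀ i j, ((Q + L p) (bv j)) i =
      (Q (bv j)) i + p.1 * (pertW G n (bv j)) i + (pertD (n + 1) p.2 (bv j)) i := by
    intro i j
    show (Q (bv j)) i + (p.1 * (pertW G n (bv j)) i + (pertD (n + 1) p.2 (bv j)) i) = _
    ring
  have hmat : stMat a (n + 1) (Q + L p) =
      stMat a (n + 1) Q + p.1 • E + Matrix.diagonal p.2 := by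
    ext i j
    simp only [stMat, Matrix.of_apply, Matrix.add_apply, Matrix.smul_apply, E, hco, pertD_coord,
      Matrix.diagonal_apply, smul_eq_mul, i.2, dif_pos, Fin.ext_iff]
    ring
  refine ⟨Q + L p, ⟨?_, ?_, ?_, ?_, ?_⟩, ?_, ?_⟩
  · intro x y
    have e1 := h.sym x y
    have e2 := pertW_sym G n x y
    have e3 := pertD_sym (n + 1) p.2 x y
    show inner ℝ (Q x + (p.1 • pertW G n x + pertD (n + 1) p.2 x)) y =
      inner ℝ x (Q y + (p.1 • pertW G n y + pertD (n + 1) p.2 y))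
    simp only [inner_add_left, inner_add_right, inner_smul_left, inner_smul_right, e1, e2, e3]
    simp
  · intro j hj
    apply lp.ext; ext i
    rw [hco, hz' _ _ (by omega), pertD_coord, pertW_coord, nbr_apply]
    have h1 : ¬ j < n := by omega
    have h2 : n ≠ j := by omega
    have h3 : ∀ h : i < n + 1, i ≠ j := by omega
    simp only [h2]
    by_cases hi : i < n + 1
    · simp [hi, h3 hi, h1]
    · simp [hi, h1]
  · intro i j hi hj hij
    rw [hco, pertD_coord, pertW_coord, nbr_apply, nbr_apply]
    simp only [hi, hij, dif_pos, if_false, add_zero]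
    by_cases hin : n = i
    · subst hin
      have hjn : j < n := by omega
      simp [hz n _ le_rfl, hjn, hij, hp1, G.adj_comm]
    · by_cases hjn : n = j
      · subst hjn
        have : i < n := by omega
        simp [hz' i n le_rfl, this, hin, hp1]
      · simp only [hin, hjn, if_false, mul_zero, zero_mul, add_zero]
        exact h.adj i j (by omega) (by omega) hij
  · intro k
    rw [hmat]; exact hpd k
  · rw [hmat]; exact hpj
  · simpa using hp
  · intro i j hi hj hij
    have h1 : n ≠ i := by omega
    have h2 : n ≠ j := by omega
    rw [hco, pertD_coord, pertW_coord]
    simp [hij, h1, h2]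

theorem exists_dense_seq (Λ : Set ℝ) (hinf : Λ.Infinite) :
    ∃ a : ℕ → ℝ, Function.Injective a ∧ (∀ k, a k ∈ Λ) ∧ Λ ⊆ closure (Set.range a) := by
  obtain ⟨s, hs, hc, hd⟩ := TopologicalSpace.IsSeparable.exists_countable_dense_subset
    (TopologicalSpace.IsSeparable.of_separableSpace Λ)
  have hsi : s.Infinite := by
    intro hf
    rw [hf.isClosed.closure_eq] at hd
    exact hinf (hf.subset hd)
  have : Infinite s := hsi.to_subtype
  have : Countable s := hc.to_subtype
  obtain ⟨e⟩ := nonempty_equiv_of_countable (α := ℕ) (β := s)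
  refine ⟨fun k => e k, fun i j hij => e.injective (Subtype.ext hij), fun k => hs (e k).2, ?_⟩
  have : Set.range (fun k => (e k : ℝ)) = s := by
    ext x; constructor
    · rintro ⟨k, rfl⟩; exact (e k).2
    · intro hx; exact ⟨e.symm ⟨x, hx⟩, by simp⟩
  rw [this]; exact hd

/-- **Main theorem.** Given any graph `G` on the countably infinite vertex
set `ℕ` and any closed, infinite set `Λ ⊆ ℝ`, there is a self-adjoint unbounded operator
`T` on `ℓ²` such that (i) the spectrum of `T` equals `Λ`, and (ii) each standard basis
vector `e i` lies in `Dom T` and, for distinct `i j`, the matrix entry `⟪T e_j, e_i⟫` is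
nonzero precisely when `i` and `j` are adjacent in `G`. -/
theorem inverse_spectrum_problem_infinite_graph_unbounded
    (G : SimpleGraph ℕ) (Λ : Set ℝ) (hΛclosed : IsClosed Λ) (hΛinf : Λ.Infinite) :
    ∃ T : lp (fun _ : ℕ => ℝ) 2 →ₗ.[ℝ] lp (fun _ : ℕ => ℝ) 2,
      IsSelfAdjoint T ∧
      unbSpectrum T = Λ ∧
      ∃ he : ∀ i : ℕ, lp.single 2 i (1 : ℝ) ∈ T.domain,
        ∀ i j : ℕ, i ≠ j →
          (inner (𝕜 := ℝ) (T ⟨lp.single 2 j (1 : ℝ), he j⟩) (lp.single 2 i (1 : ℝ)) ≠ 0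
            ↔ G.Adj i j) := by
  obtain ⟨a, ha, haΛ, hda⟩ := exists_dense_seq Λ hΛinf
  have hstep : ∀ (n : ℕ) (Q : {Q : HH →L[ℝ] HH // Stage G a n Q}),
      ∃ Q' : {Q : HH →L[ℝ] HH // Stage G a (n + 1) Q}, ‖Q'.1 - Q.1‖ < 1 / 2 / 2 ^ n ∧
        ∀ i j, i < n → j < n → i ≠ j → (Q'.1 (bv j)) i = (Q.1 (bv j)) i := by
    intro n Q
    obtain ⟨Q', h1, h2, h3⟩ := stage_step ha Q.2 (1 / 2 / 2 ^ n) (by positivity)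
    exact ⟨⟨Q', h1⟩, h2, h3⟩
  choose nxt hn1 hn2 using hstep
  let F : (n : ℕ) → {Q : HH →L[ℝ] HH // Stage G a n Q} :=
    fun n => Nat.rec ⟨0, stage_zero G a⟩ (fun n Q => nxt n Q) n
  have hF : ∀ n, F (n + 1) = nxt n (F n) := fun n => rfl
  let q : ℕ → (HH →L[ℝ] HH) := fun n => (F n).1
  have hst : ∀ n, Stage G a n (q n) := fun n => (F n).2
  have hdist : ∀ n, dist (q n) (q (n + 1)) ≤ 1 / 2 / 2 ^ n := by
    intro n
    rw [dist_comm, dist_eq_norm]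
    exact (hn1 n (F n)).le
  obtain ⟨Q, hQ⟩ := cauchySeq_tendsto_of_complete (cauchySeq_of_le_geometric_two hdist)
  have happ : ∀ x, Filter.Tendsto (fun n => q n x) Filter.atTop (nhds (Q x)) := by
    intro x
    exact ((ContinuousLinearMap.apply ℝ HH x).continuous.tendsto Q).comp hQ
  have hsym : SymOp Q := by
    intro x y
    have h1 : Filter.Tendsto (fun n => inner ℝ (q n x) y) Filter.atTop (nhds (inner ℝ (Q x) y)) :=
      (happ x).inner tendsto_const_nhds
    have h2 : Filter.Tendsto (fun n => inner ℝ x (q n y)) Filter.atTop (nhds (inner ℝ x (Q y))) :=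
      tendsto_const_nhds.inner (happ y)
    refine tendsto_nhds_unique h1 (h2.congr fun n => ((hst n).sym x y).symm)
  have hnear : ∀ ε > 0, ∃ n, ‖Q - q n‖ < ε := by
    intro ε hε
    obtain ⟨n, hn⟩ := ((Metric.tendsto_nhds.1 hQ) ε hε).exists
    exact ⟨n, by rwa [← dist_eq_norm, dist_comm]⟩
  have hsa := opT_selfAdjoint a Q hsym
  refine ⟨opT a Q, hsa, ?_, fun i => bv_mem a i, ?_⟩
  · ext l
    rw [unbSpectrum, Set.mem_compl_iff]
    constructor
    · intro hl
      by_contra hlΛ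
      apply hl
      obtain ⟨d, hd, hball⟩ := Metric.isOpen_iff.1 hΛclosed.isOpen_compl l hlΛ
      have hk : ∀ k, d ≤ |a k - l| := by
        intro k
        by_contra hlt
        push Not at hlt
        have : a k ∈ Metric.ball l d := by rw [Metric.mem_ball, Real.dist_eq]; exact hlt
        exact hball this (haΛ k)
      apply resolvent_of_bound _ hsa l (d / 2) (by positivity)
      intro x
      obtain ⟨n, hn⟩ := hnear (d / 2) (by positivity)
      have h1 := stage_bound ha (hst n) l d hd.le hk ⟨x.1, x.2⟩
      have h2 := opT_sub a Q (q n) x.1 x.2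
      have h3 : opT a (q n) ⟨x.1, x.2⟩ - l • (x : HH) =
          (opT a Q x - l • (x : HH)) - (Q - q n) x := by
        have h2' : opT a Q x = opT a (q n) ⟨x.1, x.2⟩ + (Q - q n) x := h2
        rw [h2']; abel
      have h4 := (Q - q n).le_of_opNorm_le hn.le (x : HH)
      have h5 := norm_sub_le (opT a Q x - l • (x : HH)) ((Q - q n) x)
      rw [← h3] at h5
      have h6 : d * ‖(x : HH)‖ ≤ ‖opT a (q n) ⟨x.1, x.2⟩ - l • (x : HH)‖ := h1
      linarith
    · intro hl
      apply not_resolvent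
      intro ε hε
      obtain ⟨y, ⟨k, rfl⟩, hy⟩ := Metric.mem_closure_iff.1 (hda hl) (ε / 2) (by positivity)
      obtain ⟨n, hn⟩ := hnear (ε / 2) (by positivity)
      obtain ⟨b, hb0, hbe, -⟩ := stage_basis ha (hst n)
      obtain ⟨hm, he⟩ := hbe k
      refine ⟨⟨b k, hm⟩, hb0 k, ?_⟩
      have h2 := opT_sub a Q (q n) (b k) hm
      have h3 : opT a Q ⟨b k, hm⟩ - l • b k = (a k - l) • b k + (Q - q n) (b k) := by
        have h2' : opT a Q ⟨b k, hm⟩ = a k • b k + (Q - q n) (b k) := by rw [← he]; exact h2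
        rw [h2', sub_smul]; abel
      have h4 := (Q - q n).le_of_opNorm_le hn.le (b k)
      have h5 := norm_add_le ((a k - l) • b k) ((Q - q n) (b k))
      rw [norm_smul] at h5
      have h6 : ‖a k - l‖ ≤ ε / 2 := by
        rw [Real.dist_eq, abs_sub_comm] at hy; exact hy.le
      have h7 : ‖a k - l‖ * ‖b k‖ ≤ ε / 2 * ‖b k‖ := by gcongr
      show ‖opT a Q ⟨b k, hm⟩ - l • b k‖ ≤ ε * ‖b k‖
      rw [h3]
      linarith
  · intro i j hij
    have e1 : inner (𝕜 := ℝ) (opT a Q ⟨bv j, bv_mem a j⟩) (bv i) = (Q (bv j)) i := by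
      rw [opT_bv, inner_bv_right, lp.coeFn_add, Pi.add_apply, lp.coeFn_smul, Pi.smul_apply,
        bv_apply]
      simp [Ne.symm hij]
    show inner (𝕜 := ℝ) (opT a Q ⟨bv j, bv_mem a j⟩) (bv i) ≠ 0 ↔ _
    rw [e1]
    let m := max i j + 1
    have hi : i < m := by simp only [m]; omega
    have hj : j < m := by simp only [m]; omega
    have hconst : ∀ t, (q (m + t) (bv j)) i = (q m (bv j)) i := by
      intro t
      induction t with
      | zero => rfl
      | succ t ih =>
        rw [← ih]
        exact hn2 (m + t) (F (m + t)) i j (by omega) (by omega) hij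
    have hlim : Filter.Tendsto (fun n => (q n (bv j)) i) Filter.atTop (nhds ((Q (bv j)) i)) := by
      have h1 : Filter.Tendsto (fun n => inner ℝ (bv i) (q n (bv j))) Filter.atTop
        (nhds (inner ℝ (bv i) (Q (bv j)))) := tendsto_const_nhds.inner (happ (bv j))
      simpa only [inner_bv_left] using h1
    have hlim2 : Filter.Tendsto (fun n => (q n (bv j)) i) Filter.atTop
        (nhds ((q m (bv j)) i)) := by
      apply tendsto_const_nhds.congr'
      filter_upwards [Filter.eventually_ge_atTop m] with n hn
      obtain ⟨t, rfl⟩ := Nat.exists_eq_add_of_le hn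
      exact (hconst t).symm
    rw [tendsto_nhds_unique hlim hlim2]
    exact (hst m).adj i j hi hj hij
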